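/- arXiv:2408.00154 — 12 statements merged into one kernel-verified Lean document; each statement's English description precedes it below -/
import Mathlib

section
/- Let R > 0 and 0 < ε < R. Let P : ℝ → ℝ be differentiable on [R−ε, R], let ρ : ℝ → ℝ be continuous on [R−ε, R], and let m : ℝ → ℝ be continuous on [R−ε, R] with r − 2·m(r) > 0 for all r ∈ [R−ε, R]. Assume the TOV equation holds at every r ∈ [R−ε, R], that P(R) = 0, that P(r) < 0 for all r ∈ (R−ε, R), and that m(R) < 0 (negative total mass). Then there exist c < d in [R−ε, R] such that P(r) + ρ(r) > 0 for all r ∈ (c, d); i.e., the null energy condition holds strictly on a subinterval near the boundary. -/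
open Real Set

/-- Proposition 2 of the paper: a negative-mass star with negative pressure just
inside its boundary must satisfy the null energy condition (strictly) on some
subinterval of `[R-ε, R]`. -/
theorem nec_near_boundary_of_negative_mass
    (R ε : ℝ) (hR : 0 < R) (hε : 0 < ε) (hεR : ε < R)
    (P ρ m : ℝ → ℝ)
    (hP : DifferentiableOn ℝ P (Set.Icc (R - ε) R))
    (hρ : ContinuousOn ρ (Set.Icc (R - ε) R))
    (hm : ContinuousOn m (Set.Icc (R - ε) R))
    (hhor : ∀ r ∈ Set.Icc (R - ε) R, 0 < r - 2 * m r)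
    (hTOV : ∀ r ∈ Set.Icc (R - ε) R,
      deriv P r = -(P r + ρ r) * (4 * Real.pi * P r * r ^ 3 + m r) / (r * (r - 2 * m r)))
    (hPR : P R = 0)
    (hPneg : ∀ r ∈ Set.Ioo (R - ε) R, P r < 0)
    (hM : m R < 0) :
    ∃ c d : ℝ, c < d ∧ c ∈ Set.Icc (R - ε) R ∧ d ∈ Set.Icc (R - ε) R ∧
      ∀ r ∈ Set.Ioo c d, 0 < P r + ρ r := by
  have hPc := hP.continuousOn
  have hg : ContinuousOn (fun r => 4 * Real.pi * P r * r ^ 3 + m r) (Set.Icc (R - ε) R) := by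
    fun_prop
  have hRmem : R ∈ Set.Icc (R - ε) R := ⟨by linarith, le_rfl⟩
  have hgR : {r | 4 * Real.pi * P r * r ^ 3 + m r < 0} ∈ nhdsWithin R (Set.Icc (R - ε) R) :=
    (hg R hRmem).eventually_lt_const (by simpa [hPR] using hM)
  obtain ⟨δ, hδ, hball⟩ := Metric.mem_nhdsWithin_iff.1 hgR
  obtain ⟨a, ha, haR⟩ : ∃ a, max (R - ε) (R - δ) < a ∧ a < R :=
    exists_between (max_lt (by linarith) (by linarith))
  obtain ⟨haε, haδ⟩ := max_lt_iff.1 ha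
  obtain ⟨ξ, ⟨haξ, hξR⟩, hξ⟩ := exists_deriv_eq_slope P haR
    (hPc.mono (Set.Icc_subset_Icc_left haε.le))
    (hP.mono (Set.Ioo_subset_Icc_self.trans (Set.Icc_subset_Icc_left haε.le)))
  have hξε : R - ε < ξ := haε.trans haξ
  have hξmem : ξ ∈ Set.Icc (R - ε) R := ⟨hξε.le, hξR.le⟩
  have hslope : 0 < deriv P ξ := by
    rw [hξ, hPR]
    exact div_pos (by linarith [hPneg a ⟨haε, haR⟩]) (by linarith)
  have hgξ : 4 * Real.pi * P ξ * ξ ^ 3 + m ξ < 0 := by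
    refine hball ⟨?_, hξmem⟩
    rw [Metric.mem_ball, Real.dist_eq, abs_lt]
    constructor <;> linarith
  have hnec : 0 < P ξ + ρ ξ := by
    have hden : 0 < ξ * (ξ - 2 * m ξ) := mul_pos (by linarith) (hhor ξ hξmem)
    rw [hTOV ξ hξmem, div_pos_iff_of_pos_right hden] at hslope
    nlinarith
  have hnhds : {r | 0 < P r + ρ r} ∈ nhds ξ :=
    ((hPc.add hρ).continuousAt (Icc_mem_nhds hξε hξR)).eventually_const_lt hnec
  obtain ⟨l, u, ⟨hl, hu⟩, hsub⟩ := mem_nhds_iff_exists_Ioo_subset.1 hnhds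
  have hc : max l (R - ε) < ξ := max_lt hl hξε
  have hd : ξ < min u R := lt_min hu hξR
  exact ⟨max l (R - ε), min u R, hc.trans hd, ⟨le_max_right _ _, (hc.trans hξR).le⟩,
    ⟨(hξε.trans hd).le, min_le_right _ _⟩,
    fun r hr => hsub ⟨(le_max_left _ _).trans_lt hr.1, hr.2.trans_le (min_le_left _ _)⟩⟩
end

section
/- Let R > 0 and M < 0, and let P, ρ, m : ℝ → ℝ with m(R) = M, P(R) = 0, ρ(R) > 0, P differentiable at R, and suppose the TOV equation holds at r = R. Then P'(R) = −ρ(R)·M / (R·(R − 2M)) > 0. Consequently there exists δ > 0 such that P(r) < 0 for all r ∈ (R−δ, R): a negative-mass star whose energy density is positive at the surface must have negative pressure just inside the surface. -/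
open Real Set

/-- A negative-mass star with positive energy density at the surface has
`P'(R) = -ρ(R)·M/(R·(R-2M)) > 0`, and consequently negative pressure just inside
the surface. -/
theorem negative_pressure_near_surface
    (R M : ℝ) (hR : 0 < R) (hM : M < 0)
    (P ρ m : ℝ → ℝ)
    (hmR : m R = M) (hPR : P R = 0) (hρR : 0 < ρ R)
    (hP : DifferentiableAt ℝ P R)
    (hTOV : deriv P R =
      -(P R + ρ R) * (4 * Real.pi * P R * R ^ 3 + m R) / (R * (R - 2 * m R))) :
    deriv P R = -(ρ R) * M / (R * (R - 2 * M)) ∧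
      0 < deriv P R ∧
      ∃ δ > 0, ∀ r ∈ Set.Ioo (R - δ) R, P r < 0 := by
  have hderiv : deriv P R = -(ρ R) * M / (R * (R - 2 * M)) := by
    simpa [hPR, hmR] using hTOV
  have hpos : 0 < deriv P R := by
    rw [hderiv]
    exact div_pos (by nlinarith) (mul_pos hR (by linarith))
  refine ⟨hderiv, hpos, ?_⟩
  obtain ⟨δ, hδ, hball⟩ :=
    Metric.eventually_nhds_iff.mp (eventually_nhdsWithin_sign_eq_of_deriv_pos hpos hPR)
  refine ⟨δ, hδ, fun r hr => ?_⟩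
  have hdist : dist r R < δ := by
    rw [Real.dist_eq, abs_lt]
    constructor <;> linarith [hr.1, hr.2]
  rw [← sign_eq_neg_one_iff, hball hdist, sign_eq_neg_one_iff]
  linarith [hr.2]
end

section
/- Let a > 0 and let f : ℝ → ℝ be differentiable. Let ρ, P : ℝ → ℝ with P = f ∘ ρ on [0, a), let m(r) = ∫₀^r 4π·ρ(s)·s² ds, and suppose P is differentiable and satisfies the TOV equation on (0, a). Then: (1) if ρ(r) = 0 for all r ∈ [0, a), then P(r) = 0 for all r ∈ [0, a); (2) consequently the equation of state satisfies f(0) = 0; (3) if moreover f is monotone nondecreasing and f(0) = 0, then f(x) + x < 0 for every x < 0, i.e., the null energy condition is violated at every point with negative energy density. -/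
open Real Set

/-- Proposition 1 of the paper: vacuum solutions of the TOV equation force vanishing
pressure, the barotropic equation of state then satisfies `f 0 = 0`, and a monotone
nondecreasing equation of state with `f 0 = 0` violates the null energy condition at
every negative energy density. -/
theorem vacuum_tov_and_nec_violation
    (a : ℝ) (ha : 0 < a)
    (f : ℝ → ℝ) (hf : Differentiable ℝ f)
    (ρ P : ℝ → ℝ)
    (hEoS : ∀ r ∈ Set.Ico (0 : ℝ) a, P r = f (ρ r))
    (m : ℝ → ℝ) (hm : ∀ r, m r = ∫ s in (0 : ℝ)..r, 4 * Real.pi * ρ s * s ^ 2)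
    (hPdiff : ∀ r ∈ Set.Ioo (0 : ℝ) a, DifferentiableAt ℝ P r)
    (hTOV : ∀ r ∈ Set.Ioo (0 : ℝ) a,
      deriv P r = -(P r + ρ r) * (4 * Real.pi * P r * r ^ 3 + m r) / (r * (r - 2 * m r))) :
    ((∀ r ∈ Set.Ico (0 : ℝ) a, ρ r = 0) → ∀ r ∈ Set.Ico (0 : ℝ) a, P r = 0) ∧
    ((∀ r ∈ Set.Ico (0 : ℝ) a, ρ r = 0) → f 0 = 0) ∧
    (Monotone f → f 0 = 0 → ∀ x : ℝ, x < 0 → f x + x < 0) := by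
  have eos_zero : (∀ r ∈ Set.Ico (0 : ℝ) a, ρ r = 0) → f 0 = 0 := by
    intro hρ
    have hP : ∀ r ∈ Set.Ico (0 : ℝ) a, P r = f 0 := fun r hr => by rw [hEoS r hr, hρ r hr]
    have hr : a / 2 ∈ Set.Ioo (0 : ℝ) a := ⟨half_pos ha, half_lt_self ha⟩
    have hderiv : deriv P (a / 2) = 0 := by
      have hconst : P =ᶠ[nhds (a / 2)] fun _ => f 0 := by
        filter_upwards [Ioo_mem_nhds hr.1 hr.2] with r hr'
        exact hP r (Set.Ioo_subset_Ico_self hr')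
      rw [hconst.deriv_eq, deriv_const]
    have hmass : m (a / 2) = 0 := by
      rw [hm]
      refine intervalIntegral.integral_zero_ae (Filter.Eventually.of_forall fun s hs => ?_)
      rw [Set.uIoc_of_le hr.1.le] at hs
      simp [hρ s ⟨hs.1.le, hs.2.trans_lt hr.2⟩]
    have h := hTOV _ hr
    rw [hderiv, hmass, hP _ (Set.Ioo_subset_Ico_self hr),
      hρ _ (Set.Ioo_subset_Ico_self hr)] at h
    simpa [ha.ne', Real.pi_ne_zero] using h.symm
  refine ⟨fun hρ r hr => ?_, eos_zero, fun hmono hf0 x hx => ?_⟩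
  · rw [hEoS r hr, hρ r hr, eos_zero hρ]
  · linarith [hmono hx.le]
end

section
/- Let g : ℝ → ℝ be differentiable with g'(x) ≥ 0 for all x (barotropic relation ρ = g(P) with nonnegative slope). Let P : [0, ∞) → ℝ be differentiable with P(0) < 0 and g(P(0)) < 0, set ρ = g ∘ P and m(r) = ∫₀^r 4π·ρ(s)·s² ds, and assume the TOV equation holds for all r > 0. Then for every r > 0 one has P(r) < 0, ρ(r) < 0, m(r) < 0 and P'(r) ≤ 0. In particular there is no R > 0 with P(R) = 0: a star with everywhere negative central pressure and density and nondecreasing barotropic equation of state cannot have finite radius. -/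
open Real Set

/-- The enclosed mass of a continuous density that is negative inside radius `r` is negative. -/
lemma mass_neg_of_density_neg {ρ : ℝ → ℝ} {r : ℝ} (hr : 0 < r)
    (hc : ContinuousOn ρ (Icc 0 r)) (hneg : ∀ s ∈ Ioo 0 r, ρ s < 0) :
    ∫ s in (0 : ℝ)..r, 4 * Real.pi * ρ s * s ^ 2 < 0 := by
  have hpos : 0 < ∫ s in (0 : ℝ)..r, -(4 * Real.pi * ρ s * s ^ 2) := by
    refine intervalIntegral.intervalIntegral_pos_of_pos_on ?_ (fun s hs => ?_) hr
    · apply ContinuousOn.intervalIntegrable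
      rw [uIcc_of_le hr.le]
      fun_prop
    · have h : 0 < 4 * Real.pi * -ρ s * s ^ 2 :=
        mul_pos (mul_pos (by positivity) (neg_pos.2 (hneg s hs))) (pow_pos hs.1 2)
      linarith
  rw [intervalIntegral.integral_neg] at hpos
  linarith

/-- The right-hand side of the TOV equation is nonpositive when the pressure, density and mass
are negative. -/
lemma tov_rhs_nonpos {p ρ m r : ℝ} (hr : 0 < r) (hp : p < 0) (hρ : ρ < 0) (hm : m < 0) :
    -(p + ρ) * (4 * Real.pi * p * r ^ 3 + m) / (r * (r - 2 * m)) ≤ 0 := by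
  have h : 4 * Real.pi * p * r ^ 3 < 0 :=
    mul_neg_of_neg_of_pos (mul_neg_of_pos_of_neg (by positivity) hp) (by positivity)
  exact div_nonpos_of_nonpos_of_nonneg
    (mul_nonpos_of_nonneg_of_nonpos (by linarith) (by linarith))
    (mul_nonneg hr.le (by linarith))

/-- A star with negative central pressure and density and a nondecreasing barotropic
equation of state `ρ = g(P)` has `P < 0`, `ρ < 0`, `m < 0` and `P' ≤ 0` at every radius,
hence cannot have a finite radius where the pressure vanishes. -/
theorem negative_pressure_star_is_infinite
    (g : ℝ → ℝ) (hg : Differentiable ℝ g) (hg' : ∀ x, 0 ≤ deriv g x)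
    (P : ℝ → ℝ) (hP : DifferentiableOn ℝ P (Set.Ici (0 : ℝ)))
    (hP0 : P 0 < 0) (hρ0 : g (P 0) < 0)
    (ρ : ℝ → ℝ) (hρ : ρ = g ∘ P)
    (m : ℝ → ℝ) (hm : ∀ r, m r = ∫ s in (0 : ℝ)..r, 4 * Real.pi * ρ s * s ^ 2)
    (hTOV : ∀ r : ℝ, 0 < r →
      deriv P r = -(P r + ρ r) * (4 * Real.pi * P r * r ^ 3 + m r) / (r * (r - 2 * m r))) :
    (∀ r : ℝ, 0 < r → P r < 0 ∧ ρ r < 0 ∧ m r < 0 ∧ deriv P r ≤ 0) ∧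
      ¬ ∃ R : ℝ, 0 < R ∧ P R = 0 := by
  have hmono : Monotone g := monotone_of_deriv_nonneg hg hg'
  have hPc : ContinuousOn P (Ici 0) := hP.continuousOn
  have hρc : ContinuousOn ρ (Ici 0) := hρ ▸ hg.continuous.comp_continuousOn hPc
  have hρP : ∀ r, ρ r = g (P r) := fun r => by rw [hρ]; rfl
  have hmass : ∀ r, 0 < r → (∀ s ∈ Ioo 0 r, ρ s < 0) → m r < 0 := fun r hr h => by
    rw [hm]
    exact mass_neg_of_density_neg hr (hρc.mono Icc_subset_Ici_self) h
  have hneg : ∀ r, 0 ≤ r → P r < 0 ∧ ρ r < 0 := by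
    by_contra hcon
    let S : Set ℝ := Ici 0 ∩ (fun r => max (P r) (ρ r)) ⁻¹' Ici 0
    have hSclosed : IsClosed S :=
      (hPc.sup hρc).preimage_isClosed_of_isClosed isClosed_Ici isClosed_Ici
    have hSne : S.Nonempty := by
      push Not at hcon
      obtain ⟨r, hr, h⟩ := hcon
      refine ⟨r, hr, ?_⟩
      change 0 ≤ max (P r) (ρ r)
      by_contra! hlt
      rw [max_lt_iff] at hlt
      exact not_le.2 hlt.2 (h hlt.1)
    have hSbdd : BddBelow S := ⟨0, fun r hr => hr.1⟩
    obtain ⟨hR0, hR⟩ := hSclosed.csInf_mem hSne hSbdd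
    set R := sInf S
    have hbefore : ∀ s, 0 ≤ s → s < R → P s < 0 ∧ ρ s < 0 := fun s hs hsR => by
      rw [← max_lt_iff]
      by_contra! h
      exact not_le.2 hsR (csInf_le hSbdd ⟨hs, h⟩)
    have hanti : AntitoneOn P (Icc 0 R) := by
      refine antitoneOn_of_deriv_nonpos (convex_Icc 0 R) (hPc.mono Icc_subset_Ici_self)
        (hP.mono (interior_subset.trans Icc_subset_Ici_self)) fun s hs => ?_
      rw [interior_Icc] at hs
      obtain ⟨hPs, hρs⟩ := hbefore s hs.1.le hs.2
      rw [hTOV s hs.1]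
      exact tov_rhs_nonpos hs.1 hPs hρs
        (hmass s hs.1 fun t ht => (hbefore t ht.1.le (ht.2.trans hs.2)).2)
    have hPR : P R ≤ P 0 := hanti ⟨le_rfl, hR0⟩ ⟨hR0, le_rfl⟩ hR0
    have hρR : ρ R ≤ g (P 0) := hρP R ▸ hmono hPR
    exact not_le.2 (max_lt (hPR.trans_lt hP0) (hρR.trans_lt hρ0)) hR
  refine ⟨fun r hr => ?_, fun ⟨R, hR, h⟩ => (hneg R hR.le).1.ne h⟩
  obtain ⟨hPr, hρr⟩ := hneg r hr.le
  have hmr := hmass r hr fun s hs => (hneg s hs.1.le).2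
  exact ⟨hPr, hρr, hmr, hTOV r hr ▸ tov_rhs_nonpos hr hPr hρr hmr⟩
end

section
/- Let R > 0 and 0 < ε < R. Let f : ℝ → ℝ be differentiable with f'(x) ≥ 0 for all x and f(0) = 0. Let ρ : ℝ → ℝ be continuous on [R−ε, R], let P = f ∘ ρ be differentiable on [R−ε, R], and let m : ℝ → ℝ be continuous on [R−ε, R] with r − 2·m(r) > 0 for all r ∈ [R−ε, R]. Assume the TOV equation holds on [R−ε, R], that P(R) = 0, and that P(r) < 0 for all r ∈ (R−ε, R). Then m(R) ≥ 0: a star with a differentiable barotropic equation of state satisfying (∂P/∂ρ) ≥ 0 everywhere and P(ρ=0) = 0 cannot have negative total mass. -/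
open Real Set

/-- Proposition 3 of the paper: a star with a differentiable barotropic equation of
state satisfying `(∂P/∂ρ) ≥ 0` everywhere and `P(ρ=0) = 0` cannot have negative total
mass. -/
theorem no_negative_mass_for_nondecreasing_barotropic
    (R ε : ℝ) (hR : 0 < R) (hε : 0 < ε) (hεR : ε < R)
    (f : ℝ → ℝ) (hf : Differentiable ℝ f) (hf' : ∀ x, 0 ≤ deriv f x) (hf0 : f 0 = 0)
    (ρ : ℝ → ℝ) (hρ : ContinuousOn ρ (Set.Icc (R - ε) R))
    (P : ℝ → ℝ) (hEoS : P = f ∘ ρ)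
    (hPdiff : DifferentiableOn ℝ P (Set.Icc (R - ε) R))
    (m : ℝ → ℝ) (hm : ContinuousOn m (Set.Icc (R - ε) R))
    (hhor : ∀ r ∈ Set.Icc (R - ε) R, 0 < r - 2 * m r)
    (hTOV : ∀ r ∈ Set.Icc (R - ε) R,
      deriv P r = -(P r + ρ r) * (4 * Real.pi * P r * r ^ 3 + m r) / (r * (r - 2 * m r)))
    (hPR : P R = 0)
    (hPneg : ∀ r ∈ Set.Ioo (R - ε) R, P r < 0) :
    0 ≤ m R := by
  have hmono : Monotone f := monotone_of_deriv_nonneg hf hf'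
  by_contra! hmR
  have hRmem : R ∈ Icc (R - ε) R := ⟨by linarith, le_rfl⟩
  have hm_neg : ∀ᶠ r in nhdsWithin R (Icc (R - ε) R), m r < 0 :=
    (hm R hRmem).eventually (gt_mem_nhds hmR)
  obtain ⟨δ, hδ, hball⟩ := Metric.mem_nhdsWithin_iff.1 hm_neg
  obtain ⟨a, ha, haR⟩ := exists_between (show max (R - ε) (R - δ) < R from
    max_lt (by linarith) (by linarith))
  obtain ⟨haε, haδ⟩ := max_lt_iff.1 ha
  have hanti : StrictAntiOn P (Icc a R) := by
    refine strictAntiOn_of_deriv_neg (convex_Icc a R)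
      (hPdiff.continuousOn.mono (Icc_subset_Icc_left haε.le)) fun r hr => ?_
    rw [interior_Icc] at hr
    have hrmem : r ∈ Icc (R - ε) R := ⟨by linarith [hr.1], hr.2.le⟩
    have hr0 : 0 < r := by linarith [hrmem.1]
    have hmr : m r < 0 := hball
      ⟨by rw [Metric.mem_ball, Real.dist_eq, abs_lt]; constructor <;> linarith [hr.1, hr.2], hrmem⟩
    have hPr : P r < 0 := hPneg r ⟨by linarith [hr.1], hr.2⟩
    have hρr : ρ r < 0 := by
      refine hmono.reflect_lt ?_
      rw [hf0]
      simpa [hEoS] using hPr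
    have hsource : 4 * Real.pi * P r * r ^ 3 + m r < 0 := by
      have : 4 * Real.pi * P r * r ^ 3 < 0 :=
        mul_neg_of_neg_of_pos (mul_neg_of_pos_of_neg (by positivity) hPr) (by positivity)
      linarith
    rw [hTOV r hrmem]
    exact div_neg_of_neg_of_pos (mul_neg_of_pos_of_neg (by linarith) hsource)
      (mul_pos hr0 (hhor r hrmem))
  have hPa := hanti (left_mem_Icc.2 haR.le) (right_mem_Icc.2 haR.le) haR
  linarith [hPneg a ⟨haε, haR⟩]
end

section
/- Let R > 0, let ρ : ℝ → ℝ be continuous on (0, R), let f : ℝ → ℝ be continuously differentiable, let P = f ∘ ρ be differentiable on (0, R), let m(r) = ∫₀^r 4π·ρ(s)·s² ds satisfy r − 2·m(r) > 0 on (0, R), let φ be differentiable on (0, R) with φ'(r) = (4π·P(r)·r³ + m(r)) / (r·(r − 2·m(r))), and assume the TOV equation holds on (0, R). Define ψ(r) = −(1/2)·log(1 − 2·m(r)/r), s(r) = sign(P(r)+ρ(r)), and the starred pulsation coefficients p⋆(r) = e^{ψ(r)+3φ(r)}·|ρ(r)+P(r)|·f'(ρ(r)) / r², q⋆(r) = s(r)·e^{ψ(r)+3φ(r)}·[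 P'(r)² / (r²·(P(r)+ρ(r))) − 4·P'(r)/r³ − 8π·P(r)·e^{2ψ(r)}·(P(r)+ρ(r)) / r² ], and w⋆(r) = e^{3ψ(r)+φ(r)}·|ρ(r)+P(r)| / r². Suppose there exists r* ∈ (0, R) with f'(ρ(r*)) < 0 and P(r*) + ρ(r*) ≠ 0. Then there exist 0 < c < d < R with P + ρ nonvanishing on [c, d] and a smooth function ζ : ℝ → ℝ, not identically zero, with support contained in (c, d), such that ∫_c^d ( p⋆(r)·ζ'(r)² − q⋆(r)·ζ(r)² ) dr < 0 and ∫_c^d w⋆(r)·ζ(r)² dr > 0. (This is the negativity of the Rayleigh quotient of the Chandrasekhar pulsation problem, i.e., the star is dynamically unstable.) -/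
open Real Set MeasureTheory
open Filter Topology

/-- A one-dimensional quadratic form `∫ p ζ'² - q ζ²` whose leading coefficient is negative at a
point takes negative values on smooth functions concentrated near that point. -/
theorem exists_smooth_trial_function_of_neg {p q w : ℝ → ℝ} {x₀ : ℝ} {U : Set ℝ} (hU : U ∈ 𝓝 x₀)
    (hp : ContinuousOn p U) (hq : ContinuousOn q U) (hw : ContinuousOn w U)
    (hp₀ : p x₀ < 0) (hw₀ : 0 < w x₀) :
    ∃ c d : ℝ, c < d ∧ Set.Icc c d ⊆ U ∧
      ∃ ζ : ℝ → ℝ, ContDiff ℝ (⊤ : ℕ∞) ζ ∧ ζ ≠ 0 ∧ Function.support ζ ⊆ Set.Ioo c d ∧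
        (∫ r in c..d, (p r * (deriv ζ r) ^ 2 - q r * (ζ r) ^ 2)) < 0 ∧
        0 < ∫ r in c..d, w r * (ζ r) ^ 2 := by
  let g : ContDiffBump (0 : ℝ) := ⟨1 / 2, 1, by norm_num, by norm_num⟩
  have hg : ContDiff ℝ (⊤ : ℕ∞) g := g.contDiff
  have hg' : Continuous (deriv g) := hg.continuous_deriv (by simp)
  have hg₀ : g 0 = 1 := g.one_of_mem_closedBall (by simp [g])
  have hg₁ : g 1 = 0 := g.zero_of_le_dist (by simp [g])
  set A : ℝ := ∫ x in (-1 : ℝ)..1, (deriv g x) ^ 2 with hA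
  set B : ℝ := ∫ x in (-1 : ℝ)..1, (g x) ^ 2 with hB
  have hApos : 0 < A := by
    obtain ⟨x, hx, hgx⟩ := exists_deriv_eq_slope g zero_lt_one hg.continuous.continuousOn
      (hg.differentiable (by simp)).differentiableOn
    refine intervalIntegral.integral_pos (by norm_num) (hg'.pow 2).continuousOn
      (fun _ _ => sq_nonneg _) ⟨x, ⟨by linarith [hx.1], hx.2.le⟩, ?_⟩
    rw [hgx, hg₀, hg₁]
    norm_num
  have hpU := hp.continuousAt hU
  have hqU := hq.continuousAt hU
  have hwU := hw.continuousAt hU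
  set a : ℝ := -p x₀ / 2 with ha
  set M : ℝ := 1 - q x₀ with hM
  have hev : ∀ᶠ x in 𝓝 x₀, x ∈ U ∧ p x < -a ∧ -M < q x ∧ 0 < w x := by
    filter_upwards [hU, hpU.eventually_lt_const (u := -a) (by linarith),
      hqU.eventually_const_lt (u := -M) (by linarith), hwU.eventually_const_lt hw₀]
      with x h₁ h₂ h₃ h₄ using ⟨h₁, h₂, h₃, h₄⟩
  obtain ⟨δ, hδ, hball⟩ := Metric.eventually_nhds_iff.1 hev
  have hsmall : ∀ᶠ ε : ℝ in 𝓝[>] 0, 0 < ε ∧ ε < δ ∧ -a * A + M * B * ε ^ 2 < 0 := by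
    have h : ContinuousAt (fun ε : ℝ => -a * A + M * B * ε ^ 2) 0 := by fun_prop
    have haA : 0 < a * A := mul_pos (by linarith) hApos
    filter_upwards [self_mem_nhdsWithin,
      nhdsWithin_le_nhds (eventually_lt_nhds hδ),
      nhdsWithin_le_nhds (h.eventually_lt_const (u := 0) (by simpa using haA))]
      with ε h₁ h₂ h₃ using ⟨h₁, h₂, h₃⟩
  obtain ⟨ε, hε, hεδ, hneg⟩ := hsmall.exists
  have hI : ∀ x ∈ Set.Icc (x₀ - ε) (x₀ + ε), x ∈ U ∧ p x < -a ∧ -M < q x ∧ 0 < w x := by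
    intro x hx
    apply hball
    rw [Real.dist_eq, abs_lt]
    constructor <;> linarith [hx.1, hx.2]
  have hsub : Set.Icc (x₀ - ε) (x₀ + ε) ⊆ U := fun x hx => (hI x hx).1
  have hcd : x₀ - ε < x₀ + ε := by linarith
  let ζ : ℝ → ℝ := fun r => g ((r - x₀) / ε)
  have hζ : ContDiff ℝ (⊤ : ℕ∞) ζ := hg.comp (by fun_prop)
  have hζ' : Continuous (deriv ζ) := hζ.continuous_deriv (by simp)
  have hderiv : ∀ r, deriv ζ r = deriv g ((r - x₀) / ε) / ε := by
    intro r
    have h₁ : HasDerivAt (fun r : ℝ => (r - x₀) / ε) (1 / ε) r :=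
      ((hasDerivAt_id r).sub_const x₀).div_const ε
    have h₂ := ((hg.differentiable (by simp)) ((r - x₀) / ε)).hasDerivAt.comp r h₁
    rw [div_eq_mul_one_div]
    exact h₂.deriv
  have hζ₀ : ζ x₀ = 1 := by simp [ζ, hg₀]
  have hscale : ∀ F : ℝ → ℝ, ∫ r in (x₀ - ε)..(x₀ + ε), F ((r - x₀) / ε) =
      ε * ∫ x in (-1 : ℝ)..1, F x := by
    intro F
    rw [intervalIntegral.integral_comp_sub_right (fun r => F (r / ε)),
      intervalIntegral.integral_comp_div _ hε.ne', smul_eq_mul]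
    congr 2 <;> field_simp <;> ring
  have hint : ∀ {h k : ℝ → ℝ}, ContinuousOn h U → Continuous k →
      ContinuousOn (fun r => h r * k r ^ 2) (Set.Icc (x₀ - ε) (x₀ + ε)) := fun hh hk =>
    (hh.mono hsub).mul (hk.pow 2).continuousOn
  refine ⟨x₀ - ε, x₀ + ε, hcd, hsub, ζ, hζ, ?_, ?_, ?_, ?_⟩
  · intro h
    rw [h] at hζ₀
    simp at hζ₀
  · intro r hr
    have h : (r - x₀) / ε ∈ Function.support g := hr
    rw [g.support_eq, Metric.mem_ball, dist_zero_right, Real.norm_eq_abs, abs_lt,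
      lt_div_iff₀ hε, div_lt_iff₀ hε] at h
    simp only [g] at h
    constructor <;> linarith [h.1, h.2]
  · calc ∫ r in (x₀ - ε)..(x₀ + ε), (p r * (deriv ζ r) ^ 2 - q r * (ζ r) ^ 2)
        ≤ ∫ r in (x₀ - ε)..(x₀ + ε), (-a * (deriv ζ r) ^ 2 + M * (ζ r) ^ 2) := by
          refine intervalIntegral.integral_mono_on hcd.le ?_ ?_ fun r hr => ?_
          · exact ((hint hp hζ').sub (hint hq hζ.continuous)).intervalIntegrable_of_Icc hcd.le
          · exact (((hζ'.pow 2).const_mul (-a)).add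
              ((hζ.continuous.pow 2).const_mul M)).intervalIntegrable _ _
          · obtain ⟨-, h₁, h₂, -⟩ := hI r hr
            nlinarith [mul_nonneg (sub_pos.2 h₁).le (sq_nonneg (deriv ζ r)),
              mul_nonneg (sub_pos.2 h₂).le (sq_nonneg (ζ r))]
      _ = ε * ∫ x in (-1 : ℝ)..1, (-a * (deriv g x / ε) ^ 2 + M * (g x) ^ 2) := by
          rw [← hscale]
          simp only [hderiv, ζ]
      _ = ε * (-a * (A / ε ^ 2) + M * B) := by
          rw [intervalIntegral.integral_add, intervalIntegral.integral_const_mul,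
            intervalIntegral.integral_const_mul]
          · simp only [div_pow, intervalIntegral.integral_div, hA, hB]
          · exact (((hg'.div_const ε).pow 2).const_mul (-a)).intervalIntegrable _ _
          · exact ((hg.continuous.pow 2).const_mul M).intervalIntegrable _ _
      _ = (-a * A + M * B * ε ^ 2) / ε := by field_simp
      _ < 0 := div_neg_of_neg_of_pos hneg hε
  · have hx₀ : x₀ ∈ Set.Icc (x₀ - ε) (x₀ + ε) := ⟨by linarith, by linarith⟩
    refine intervalIntegral.integral_pos hcd (hint hw hζ.continuous) (fun r hr => ?_)
      ⟨x₀, hx₀, ?_⟩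
    · exact mul_nonneg (hI r (Set.Ioc_subset_Icc_self hr)).2.2.2.le (sq_nonneg _)
    · simpa [hζ₀] using hw₀

/-- The primitive based at the left endpoint of a function continuous on an open interval is
continuous there. Without integrability at the endpoint the primitive is identically zero. -/
theorem continuousOn_primitive_of_continuousOn_Ioo {h : ℝ → ℝ} {a b : ℝ}
    (hh : ContinuousOn h (Set.Ioo a b)) :
    ContinuousOn (fun r => ∫ x in a..r, h x) (Set.Ioo a b) := by
  have hloc : ∀ {x y}, x ∈ Set.Ioo a b → y ∈ Set.Ioo a b → IntervalIntegrable h volume x y :=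
    fun hx hy => (hh.mono (Set.ordConnected_Ioo.uIcc_subset hx hy)).intervalIntegrable
  intro x hx
  apply ContinuousAt.continuousWithinAt
  have hIoo := Ioo_mem_nhds hx.1 hx.2
  by_cases hi : IntervalIntegrable h volume a x
  · have hd := intervalIntegral.integral_hasDerivAt_right hi
      (hh.stronglyMeasurableAtFilter isOpen_Ioo x hx) (hh.continuousAt hIoo)
    exact hd.continuousAt
  · refine continuousAt_const (y := (0 : ℝ)) |>.congr ?_
    filter_upwards [hIoo] with y hy
    exact (intervalIntegral.integral_undef fun hy' => hi (hy'.trans (hloc hy hx))).symm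

/-- Main Theorem of the paper (case `(∂P/∂ρ)_s < 0` somewhere): if the barotropic
relation has negative slope at some interior point of the star where `P + ρ ≠ 0`, then
there is a smooth compactly supported trial function making the Rayleigh quotient of
the Chandrasekhar pulsation problem negative; i.e., the star is dynamically unstable. -/
theorem negative_slope_implies_instability
    (R : ℝ) (hR : 0 < R)
    (ρ : ℝ → ℝ) (hρ : ContinuousOn ρ (Set.Ioo 0 R))
    (f : ℝ → ℝ) (hf : ContDiff ℝ 1 f)
    (P : ℝ → ℝ) (hEoS : P = f ∘ ρ)
    (hPdiff : DifferentiableOn ℝ P (Set.Ioo 0 R))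
    (m : ℝ → ℝ) (hm : ∀ r, m r = ∫ s in (0 : ℝ)..r, 4 * Real.pi * ρ s * s ^ 2)
    (hhor : ∀ r ∈ Set.Ioo 0 R, 0 < r - 2 * m r)
    (φ : ℝ → ℝ) (hφdiff : DifferentiableOn ℝ φ (Set.Ioo 0 R))
    (hφ : ∀ r ∈ Set.Ioo 0 R,
      deriv φ r = (4 * Real.pi * P r * r ^ 3 + m r) / (r * (r - 2 * m r)))
    (hTOV : ∀ r ∈ Set.Ioo 0 R,
      deriv P r = -(P r + ρ r) * (4 * Real.pi * P r * r ^ 3 + m r) / (r * (r - 2 * m r)))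
    (ψ : ℝ → ℝ) (hψ : ∀ r, ψ r = -(1 / 2) * Real.log (1 - 2 * m r / r))
    (s : ℝ → ℝ) (hs : ∀ r, s r = Real.sign (P r + ρ r))
    (pstar qstar wstar : ℝ → ℝ)
    (hpstar : ∀ r, pstar r =
      Real.exp (ψ r + 3 * φ r) * |ρ r + P r| * deriv f (ρ r) / r ^ 2)
    (hqstar : ∀ r, qstar r = s r * Real.exp (ψ r + 3 * φ r) *
      ((deriv P r) ^ 2 / (r ^ 2 * (P r + ρ r)) - 4 * deriv P r / r ^ 3
        - 8 * Real.pi * P r * Real.exp (2 * ψ r) * (P r + ρ r) / r ^ 2))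
    (hwstar : ∀ r, wstar r = Real.exp (3 * ψ r + φ r) * |ρ r + P r| / r ^ 2)
    (rstar : ℝ) (hrstar : rstar ∈ Set.Ioo 0 R)
    (hslope : deriv f (ρ rstar) < 0)
    (hnec : P rstar + ρ rstar ≠ 0) :
    ∃ c d : ℝ, 0 < c ∧ c < d ∧ d < R ∧
      (∀ r ∈ Set.Icc c d, P r + ρ r ≠ 0) ∧
      ∃ ζ : ℝ → ℝ, ContDiff ℝ (⊤ : ℕ∞) ζ ∧ ζ ≠ 0 ∧
        Function.support ζ ⊆ Set.Ioo c d ∧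
        (∫ r in c..d, (pstar r * (deriv ζ r) ^ 2 - qstar r * (ζ r) ^ 2)) < 0 ∧
        0 < ∫ r in c..d, wstar r * (ζ r) ^ 2 := by
  have hPc : ContinuousOn P (Set.Ioo 0 R) := hPdiff.continuousOn
  have hφc : ContinuousOn φ (Set.Ioo 0 R) := hφdiff.continuousOn
  have hmc : ContinuousOn m (Set.Ioo 0 R) := by
    rw [funext hm]
    exact continuousOn_primitive_of_continuousOn_Ioo (by fun_prop)
  have hne : ∀ r ∈ Set.Ioo 0 R, r ≠ 0 := fun r hr => hr.1.ne'
  have hψc : ContinuousOn ψ (Set.Ioo 0 R) := by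
    rw [funext hψ]
    refine continuousOn_const.mul (ContinuousOn.log ?_ fun r hr => ?_)
    · exact continuousOn_const.sub ((continuousOn_const.mul hmc).div continuousOn_id hne)
    · have h : 1 - 2 * m r / r = (r - 2 * m r) / r := by field_simp [hne r hr]
      rw [h]
      exact (div_pos (hhor r hr) hr.1).ne'
  have hP'c : ContinuousOn (deriv P) (Set.Ioo 0 R) := by
    refine ContinuousOn.congr (ContinuousOn.div ?_ ?_ ?_) hTOV
    · fun_prop
    · fun_prop
    · exact fun r hr => (mul_pos hr.1 (hhor r hr)).ne'
  have hfc : ContinuousOn (fun r => deriv f (ρ r)) (Set.Ioo 0 R) :=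
    (hf.continuous_deriv le_rfl).comp_continuousOn hρ
  let U : Set ℝ := {r | r ∈ Set.Ioo 0 R ∧ P r + ρ r ≠ 0}
  have hUsub : U ⊆ Set.Ioo 0 R := fun r hr => hr.1
  have hU : U ∈ 𝓝 rstar := by
    have hmem := Ioo_mem_nhds hrstar.1 hrstar.2
    filter_upwards [hmem, ((hPc.add hρ).continuousAt hmem).eventually_ne hnec] with r h₁ h₂
    exact ⟨h₁, h₂⟩
  replace hρ := hρ.mono hUsub
  replace hPc := hPc.mono hUsub
  replace hφc := hφc.mono hUsub
  replace hψc := hψc.mono hUsub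
  replace hP'c := hP'c.mono hUsub
  replace hfc := hfc.mono hUsub
  have hpow : ∀ n : ℕ, ∀ r ∈ U, r ^ n ≠ 0 := fun n r hr => pow_ne_zero n hr.1.1.ne'
  have hsc : ContinuousOn s U := by
    have h : ContinuousOn (fun r => (P r + ρ r) / |P r + ρ r|) U :=
      (hPc.add hρ).div (hPc.add hρ).abs fun r hr => abs_ne_zero.2 hr.2
    refine h.congr fun r hr => ?_
    simp only [hs]
    rcases hr.2.lt_or_gt with h | h
    · rw [Real.sign_of_neg h, abs_of_neg h, div_neg, div_self hr.2]
    · rw [Real.sign_of_pos h, abs_of_pos h, div_self hr.2]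
  have habs : 0 < |ρ rstar + P rstar| := abs_pos.2 (by rwa [add_comm])
  have hr2 : 0 < rstar ^ 2 := pow_pos hrstar.1 2
  obtain ⟨c, d, hcd, hsub, hζ⟩ := exists_smooth_trial_function_of_neg
    (p := pstar) (q := qstar) (w := wstar) hU
    (by
      rw [funext hpstar]
      refine ContinuousOn.div ?_ (by fun_prop) (hpow 2)
      exact (ContinuousOn.mul (by fun_prop) (hρ.add hPc).abs).mul hfc)
    (by
      rw [funext hqstar]
      refine ContinuousOn.mul (by fun_prop) (((ContinuousOn.div ?_ ?_ ?_).sub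
        (ContinuousOn.div ?_ ?_ (hpow 3))).sub (ContinuousOn.div ?_ ?_ (hpow 2)))
      · fun_prop
      · fun_prop
      · exact fun r hr => mul_ne_zero (hpow 2 r hr) hr.2
      all_goals fun_prop)
    (by
      rw [funext hwstar]
      refine ContinuousOn.div ?_ (by fun_prop) (hpow 2)
      exact ContinuousOn.mul (by fun_prop) (hρ.add hPc).abs)
    (by
      rw [hpstar]
      exact div_neg_of_neg_of_pos
        (mul_neg_of_pos_of_neg (mul_pos (Real.exp_pos _) habs) hslope) hr2)
    (by
      rw [hwstar]
      exact div_pos (mul_pos (Real.exp_pos _) habs) hr2)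
  exact ⟨c, d, (hsub (Set.left_mem_Icc.2 hcd.le)).1.1, hcd,
    (hsub (Set.right_mem_Icc.2 hcd.le)).1.2, fun r hr => (hsub hr).2, hζ⟩
end

section
/- Let 0 < c < d and let p, q : ℝ → ℝ be continuous on [c, d] with p(r) < 0 for all r ∈ [c, d]. Then there exists a smooth function ζ : ℝ → ℝ, not identically zero, with support contained in the open interval (c, d), such that ∫_c^d ( p(r)·ζ'(r)² − q(r)·ζ(r)² ) dr < 0. -/
open Real Set

open MeasureTheory Filter Topology

theorem HasCompactSupport.sq {f : ℝ → ℝ} (hf : HasCompactSupport f) :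
    HasCompactSupport fun x => f x ^ 2 :=
  hf.mono fun _ hx => ne_zero_pow two_ne_zero hx

theorem Continuous.integrable_sq_of_hasCompactSupport {f : ℝ → ℝ} (hf : Continuous f)
    (hc : HasCompactSupport f) : Integrable fun x => f x ^ 2 :=
  Continuous.integrable_of_hasCompactSupport (by fun_prop) hc.sq

/-- A nonzero smooth function vanishing outside the unit interval, with positive Dirichlet
energy. -/
theorem exists_bump_with_pos_energy :
    ∃ φ : ℝ → ℝ, ContDiff ℝ (⊤ : ℕ∞) φ ∧ HasCompactSupport φ ∧ φ 0 = 1 ∧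
      (∀ x, φ x ≠ 0 → |x| < 1) ∧ (∀ x, deriv φ x ≠ 0 → |x| ≤ 1) ∧
      0 < ∫ x, (deriv φ x) ^ 2 := by
  let b : ContDiffBump (0 : ℝ) := ⟨1 / 2, 1, by norm_num, by norm_num⟩
  have hb : ContDiff ℝ (⊤ : ℕ∞) b := b.contDiff
  have h0 : b 0 = 1 := b.one_of_mem_closedBall (by simp [b])
  have hd : Continuous (deriv b) := hb.continuous_deriv (by simp)
  refine ⟨b, hb, b.hasCompactSupport, h0, fun x hx => ?_, fun x hx => ?_, ?_⟩
  · have : x ∈ Function.support b := hx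
    rw [b.support_eq] at this
    simpa [b] using this
  · have : x ∈ tsupport b := support_deriv_subset hx
    rw [b.tsupport_eq] at this
    simpa [b] using this
  · have hne : ∃ x, deriv b x ≠ 0 := by
      by_contra! h
      have h2 := is_const_of_deriv_eq_zero (hb.differentiable (by simp)) h 0 2
      rw [h0, b.zero_of_le_dist (by simp [b])] at h2
      exact one_ne_zero h2
    obtain ⟨x, hx⟩ := hne
    exact (hd.pow 2).integral_pos_of_hasCompactSupport_nonneg_nonzero b.hasCompactSupport.deriv.sq
      (fun x => sq_nonneg _) (x := x) (pow_ne_zero 2 hx)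

/-- Key technical lemma: on an interval where the leading Sturm–Liouville coefficient
`p` is strictly negative, a suitable smooth bump function makes the quadratic form
`∫ (p ζ'² − q ζ²)` negative. -/
theorem bump_makes_quadratic_form_negative
    (c d : ℝ) (hc : 0 < c) (hcd : c < d)
    (p q : ℝ → ℝ)
    (hp : ContinuousOn p (Set.Icc c d)) (hq : ContinuousOn q (Set.Icc c d))
    (hpneg : ∀ r ∈ Set.Icc c d, p r < 0) :
    ∃ ζ : ℝ → ℝ, ContDiff ℝ (⊤ : ℕ∞) ζ ∧ ζ ≠ 0 ∧
      Function.support ζ ⊆ Set.Ioo c d ∧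
      (∫ r in c..d, (p r * (deriv ζ r) ^ 2 - q r * (ζ r) ^ 2)) < 0 := by
  obtain ⟨φ, hφ, hφc, hφ0, hφs, hφs', hA⟩ := exists_bump_with_pos_energy
  have hne : (Icc c d).Nonempty := nonempty_Icc.2 hcd.le
  obtain ⟨x₀, hx₀, hmax⟩ := isCompact_Icc.exists_isMaxOn hne hp
  obtain ⟨y₀, hy₀, hmin⟩ := isCompact_Icc.exists_isMinOn hne hq
  have hP := hpneg x₀ hx₀
  set P := p x₀
  set Q := q y₀
  set A := ∫ x, (deriv φ x) ^ 2
  set B := ∫ x, (φ x) ^ 2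
  have hev : ∀ᶠ a in 𝓝[>] (0 : ℝ), P * A - Q * B * a ^ 2 < 0 ∧ a < (d - c) / 2 ∧ 0 < a := by
    have h1 : Tendsto (fun a : ℝ => P * A - Q * B * a ^ 2) (𝓝[>] 0) (𝓝 (P * A)) := by
      have : Continuous (fun a : ℝ => P * A - Q * B * a ^ 2) := by fun_prop
      simpa using (this.tendsto 0).mono_left nhdsWithin_le_nhds
    filter_upwards [h1.eventually_lt_const (mul_neg_of_neg_of_pos hP hA),
      nhdsWithin_le_nhds (Iio_mem_nhds (by linarith : (0 : ℝ) < (d - c) / 2)),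
      self_mem_nhdsWithin] with a h1 h2 h3 using ⟨h1, h2, h3⟩
  obtain ⟨a, hneg, had, ha⟩ := hev.exists
  set e := (c + d) / 2 with he
  have hmem : ∀ r, |(r - e) / a| ≤ 1 → r ∈ Ioo c d := by
    intro r hr
    rw [abs_div, abs_of_pos ha, div_le_one ha, abs_le] at hr
    constructor <;> linarith [hr.1, hr.2]
  have hζ : ContDiff ℝ (⊤ : ℕ∞) (fun r => φ ((r - e) / a)) := by fun_prop
  have hζ' : ∀ r, deriv (fun r => φ ((r - e) / a)) r = deriv φ ((r - e) / a) / a := by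
    intro r
    have h1 : HasDerivAt (fun r => (r - e) / a) (1 / a) r :=
      ((hasDerivAt_id r).sub_const e).div_const a
    have h2 := (hφ.differentiable (by simp) ((r - e) / a)).hasDerivAt
    simpa [div_eq_mul_inv, Function.comp_def] using (h2.comp r h1).deriv
  refine ⟨fun r => φ ((r - e) / a), hζ, fun h => ?_, fun r hr => hmem r (hφs _ hr).le, ?_⟩
  · simpa [hφ0] using congrFun h e
  have hφ' : Continuous (deriv φ) := hφ.continuous_deriv (by simp)
  set G : ℝ → ℝ := fun u => P / a ^ 2 * (deriv φ u) ^ 2 - Q * (φ u) ^ 2 with hG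
  have hGc : Continuous G := by have := hφ.continuous; fun_prop
  have hdc : Continuous (deriv fun r => φ ((r - e) / a)) := hζ.continuous_deriv (by simp)
  have hsupp : Function.support (fun r => G ((r - e) / a)) ⊆ Ioc c d := by
    intro r hr
    refine Ioo_subset_Ioc_self (hmem r ?_)
    by_contra h
    refine hr ?_
    have h1 : φ ((r - e) / a) = 0 := by_contra fun h' => h (hφs _ h').le
    have h2 : deriv φ ((r - e) / a) = 0 := by_contra fun h' => h (hφs' _ h')
    simp [hG, h1, h2]
  calc ∫ r in c..d, (p r * (deriv (fun r => φ ((r - e) / a)) r) ^ 2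
          - q r * (φ ((r - e) / a)) ^ 2)
      ≤ ∫ r in c..d, G ((r - e) / a) := by
        refine intervalIntegral.integral_mono_on hcd.le ?_ ?_ fun r hr => ?_
        · refine ContinuousOn.intervalIntegrable_of_Icc hcd.le ?_
          exact (hp.mul (hdc.pow 2).continuousOn).sub
            (hq.mul (hζ.continuous.pow 2).continuousOn)
        · exact (hGc.comp (by fun_prop : Continuous fun r => (r - e) / a)).intervalIntegrable _ _
        · have h1 : p r ≤ P := hmax hr
          have h2 : Q ≤ q r := hmin hr
          have h3 : P / a ^ 2 * (deriv φ ((r - e) / a)) ^ 2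
              = P * (deriv φ ((r - e) / a) / a) ^ 2 := by ring
          simp only [hG, hζ', h3]
          exact sub_le_sub (mul_le_mul_of_nonneg_right h1 (sq_nonneg _))
            (mul_le_mul_of_nonneg_right h2 (sq_nonneg _))
    _ = ∫ r, G ((r - e) / a) := intervalIntegral.integral_eq_integral_of_support_subset hsupp
    _ = a * ∫ u, G u := by
        rw [integral_sub_right_eq_self (fun r => G (r / a)) e, Measure.integral_comp_div G a,
          abs_of_pos ha, smul_eq_mul]
    _ = a * (P / a ^ 2 * A - Q * B) := by
        have i1 := hφ'.integrable_sq_of_hasCompactSupport hφc.deriv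
        have i2 := hφ.continuous.integrable_sq_of_hasCompactSupport hφc
        rw [hG, integral_sub (i1.const_mul _) (i2.const_mul _), integral_const_mul,
          integral_const_mul]
    _ = (P * A - Q * B * a ^ 2) / a := by field_simp
    _ < 0 := div_neg_of_neg_of_pos hneg ha
end

section
/- For every a > 0, ∫_{−a}^{a} θ_a'(x)² dx = 4·a^{−5}·e^{2/a²}·∫_1^∞ e^{−2u/a²}·u^{3/2}·(u−1)^{1/2} du, where θ_a is the standard bump function of half-width a, θ_a' its derivative, and both integrals converge. -/
open Real Set MeasureTheory

/-- The standard bump function of half-width `a`: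
`θ_a(x) = exp(1/a²)·exp(1/(x² − a²))` for `|x| < a` and `0` otherwise. -/
noncomputable def bump (a x : ℝ) : ℝ :=
  if |x| < a then Real.exp (1 / a ^ 2) * Real.exp (1 / (x ^ 2 - a ^ 2)) else 0

theorem hasDerivAt_bump {a x : ℝ} (hx : |x| < a) :
    HasDerivAt (bump a)
      (exp (1 / a ^ 2) * (exp (1 / (x ^ 2 - a ^ 2)) * (-(2 * x) / (x ^ 2 - a ^ 2) ^ 2))) x := by
  have hne : x ^ 2 - a ^ 2 ≠ 0 := (sub_neg.2 (sq_lt_sq' (abs_lt.1 hx).1 (abs_lt.1 hx).2)).ne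
  have hd : HasDerivAt (fun y : ℝ => y ^ 2 - a ^ 2) (2 * x) x := by
    simpa using (hasDerivAt_pow 2 x).sub_const (a ^ 2)
  have hmain := ((hd.fun_inv hne).exp).const_mul (exp (1 / a ^ 2))
  simp only [← one_div (_ - _)] at hmain
  refine hmain.congr_of_eventuallyEq ?_
  filter_upwards [continuous_abs.continuousAt.eventually_lt_const hx] with y hy
  simp [bump, hy]

theorem deriv_bump_neg_sq (a x : ℝ) : deriv (bump a) (-x) ^ 2 = deriv (bump a) x ^ 2 := by
  have heven : (fun y => bump a (-y)) = bump a := by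
    ext y
    simp [bump]
  have h := deriv_comp_neg (bump a) x
  rw [heven] at h
  rw [h, neg_sq]

theorem rpow_three_halves_mul_sub_one_rpow_half {u : ℝ} (hu : 1 ≤ u) :
    u ^ ((3 : ℝ) / 2) * (u - 1) ^ ((1 : ℝ) / 2) = u * √(u * (u - 1)) := by
  have hu0 : 0 < u := by linarith
  rw [show (3 : ℝ) / 2 = 1 + 1 / 2 by norm_num, rpow_add hu0, rpow_one, mul_assoc,
    ← mul_rpow hu0.le (by linarith), ← sqrt_eq_rpow]

theorem integrableOn_exp_mul_rpow_mul_sub_one_rpow {a : ℝ} (ha : 0 < a) :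
    IntegrableOn
      (fun u : ℝ => exp (-2 * u / a ^ 2) * u ^ ((3 : ℝ) / 2) * (u - 1) ^ ((1 : ℝ) / 2))
      (Ioi (1 : ℝ)) volume := by
  have hdom : IntegrableOn (fun u : ℝ => u ^ (2 : ℝ) * exp (-(2 / a ^ 2) * u ^ (1 : ℝ)))
      (Ioi 1) volume :=
    (integrableOn_rpow_mul_exp_neg_mul_rpow (by norm_num) one_pos (by positivity)).mono_set
      (Ioi_subset_Ioi zero_le_one)
  refine hdom.mono' (by fun_prop) ?_
  filter_upwards [ae_restrict_mem measurableSet_Ioi] with u hu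
  have hu1 : 1 < u := hu
  have hu0 : 0 < u := by linarith
  have hsqrt : √(u * (u - 1)) ≤ u := sqrt_le_iff.2 ⟨hu0.le, by nlinarith⟩
  rw [mul_assoc, rpow_three_halves_mul_sub_one_rpow_half hu1.le, norm_of_nonneg (by positivity),
    rpow_one, rpow_two, show -(2 / a ^ 2) * u = -2 * u / a ^ 2 by ring, mul_comm, sq u]
  gcongr

theorem hasDerivAt_sq_div_sq_sub_sq {a x : ℝ} (hx : a ^ 2 - x ^ 2 ≠ 0) :
    HasDerivAt (fun y : ℝ => a ^ 2 / (a ^ 2 - y ^ 2)) (2 * x * a ^ 2 / (a ^ 2 - x ^ 2) ^ 2) x := by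
  have hd : HasDerivAt (fun y : ℝ => a ^ 2 - y ^ 2) (-(2 * x)) x := by
    simpa using (hasDerivAt_pow 2 x).const_sub (a ^ 2)
  refine ((hasDerivAt_const x (a ^ 2)).fun_div hd hx).congr_deriv ?_
  ring

theorem injOn_sq_div_sq_sub_sq (a : ℝ) :
    InjOn (fun y : ℝ => a ^ 2 / (a ^ 2 - y ^ 2)) (Ioo 0 a) := by
  rintro x ⟨hx0, hxa⟩ y ⟨hy0, hya⟩ hxy
  have ha : 0 < a := hx0.trans hxa
  have hx : a ^ 2 - x ^ 2 ≠ 0 := by nlinarith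
  have hy : a ^ 2 - y ^ 2 ≠ 0 := by nlinarith
  have hxy' := mul_left_cancel₀ (pow_ne_zero 2 ha.ne') ((div_eq_div_iff hx hy).1 hxy)
  exact (sq_eq_sq₀ hx0.le hy0.le).1 (by linarith)

theorem image_sq_div_sq_sub_sq {a : ℝ} (ha : 0 < a) :
    (fun y : ℝ => a ^ 2 / (a ^ 2 - y ^ 2)) '' Ioo 0 a = Ioi 1 := by
  ext u
  constructor
  · rintro ⟨x, ⟨hx0, hxa⟩, rfl⟩
    have hx : 0 < a ^ 2 - x ^ 2 := by nlinarith
    exact (one_lt_div hx).2 (by nlinarith)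
  · intro hu
    have hu1 : 1 < u := hu
    have hu0 : 0 < u := by linarith
    have hq : 0 < (u - 1) / u := div_pos (by linarith) hu0
    have hsqrt : √((u - 1) / u) < 1 :=
      (sqrt_lt' one_pos).2 (by rw [one_pow, div_lt_one hu0]; linarith)
    refine ⟨a * √((u - 1) / u), ⟨mul_pos ha (sqrt_pos.2 hq), by nlinarith⟩, ?_⟩
    simp only [mul_pow, sq_sqrt hq.le]
    rw [show a ^ 2 - a ^ 2 * ((u - 1) / u) = a ^ 2 / u by field_simp; ring]
    field_simp

theorem deriv_bump_sq_eq {a x : ℝ} (hx : x ∈ Ioo 0 a) :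
    deriv (bump a) x ^ 2 = 2 * a ^ (-(5 : ℤ)) * exp (2 / a ^ 2) *
      (|2 * x * a ^ 2 / (a ^ 2 - x ^ 2) ^ 2| • (exp (-2 * (a ^ 2 / (a ^ 2 - x ^ 2)) / a ^ 2) *
        (a ^ 2 / (a ^ 2 - x ^ 2)) ^ ((3 : ℝ) / 2) *
        (a ^ 2 / (a ^ 2 - x ^ 2) - 1) ^ ((1 : ℝ) / 2))) := by
  obtain ⟨hx0, hxa⟩ := hx
  have ha : 0 < a := hx0.trans hxa
  have hd : 0 < a ^ 2 - x ^ 2 := by nlinarith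
  have hd' : x ^ 2 - a ^ 2 = -(a ^ 2 - x ^ 2) := by ring
  rw [(hasDerivAt_bump (by rwa [abs_of_pos hx0])).deriv, hd']
  set d := a ^ 2 - x ^ 2 with hdef
  have hu : 1 ≤ a ^ 2 / d := (one_le_div hd).2 (by nlinarith)
  have hsqrt : √(a ^ 2 / d * (a ^ 2 / d - 1)) = a * x / d := by
    rw [sqrt_eq_iff_mul_self_eq_of_pos (by positivity)]
    field_simp
    rw [hdef]
    ring
  have hexp₁ : exp (2 / a ^ 2) = exp (1 / a ^ 2) ^ 2 := by
    rw [← exp_nat_mul]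
    congr 1
    push_cast
    ring
  have hexp₂ : exp (-2 * (a ^ 2 / d) / a ^ 2) = exp (1 / -d) ^ 2 := by
    rw [← exp_nat_mul]
    congr 1
    push_cast
    field_simp
  rw [mul_assoc (exp (-2 * (a ^ 2 / d) / a ^ 2)), rpow_three_halves_mul_sub_one_rpow_half hu,
    hsqrt, hexp₁, hexp₂, abs_of_pos (by positivity), smul_eq_mul, zpow_neg]
  norm_cast
  field_simp

/-- `∫_{−a}^{a} θ_a'(x)² dx = 4·a^{−5}·e^{2/a²}·∫_1^∞ e^{−2u/a²}·u^{3/2}·(u−1)^{1/2} du`,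
and both integrals converge. -/
theorem bump_deriv_sq_integral (a : ℝ) (ha : 0 < a) :
    IntervalIntegrable (fun x => (deriv (bump a) x) ^ 2) volume (-a) a ∧
    IntegrableOn
      (fun u : ℝ => Real.exp (-2 * u / a ^ 2) * u ^ ((3 : ℝ) / 2) * (u - 1) ^ ((1 : ℝ) / 2))
      (Set.Ioi (1 : ℝ)) volume ∧
    (∫ x in (-a)..a, (deriv (bump a) x) ^ 2) =
      4 * a ^ (-(5 : ℤ)) * Real.exp (2 / a ^ 2) *
        ∫ u in Set.Ioi (1 : ℝ),
          Real.exp (-2 * u / a ^ 2) * u ^ ((3 : ℝ) / 2) * (u - 1) ^ ((1 : ℝ) / 2) := by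
  have hF := integrableOn_exp_mul_rpow_mul_sub_one_rpow ha
  have hderiv : ∀ x ∈ Ioo 0 a, HasDerivWithinAt (fun y : ℝ => a ^ 2 / (a ^ 2 - y ^ 2))
      (2 * x * a ^ 2 / (a ^ 2 - x ^ 2) ^ 2) (Ioo 0 a) x := fun x hx =>
    (hasDerivAt_sq_div_sq_sub_sq (by nlinarith [hx.1, hx.2])).hasDerivWithinAt
  have hcov := integrableOn_image_iff_integrableOn_abs_deriv_smul measurableSet_Ioo hderiv
    (injOn_sq_div_sq_sub_sq a)
    (fun u : ℝ => exp (-2 * u / a ^ 2) * u ^ ((3 : ℝ) / 2) * (u - 1) ^ ((1 : ℝ) / 2))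
  have hint := integral_image_eq_integral_abs_deriv_smul measurableSet_Ioo hderiv
    (injOn_sq_div_sq_sub_sq a)
    (fun u : ℝ => exp (-2 * u / a ^ 2) * u ^ ((3 : ℝ) / 2) * (u - 1) ^ ((1 : ℝ) / 2))
  rw [image_sq_div_sq_sub_sq ha] at hcov hint
  have hright : IntervalIntegrable (fun x => deriv (bump a) x ^ 2) volume 0 a := by
    rw [intervalIntegrable_iff_integrableOn_Ioo_of_le ha.le]
    exact IntegrableOn.congr_fun ((hcov.1 hF).const_mul _)
      (fun x hx => (deriv_bump_sq_eq hx).symm) measurableSet_Ioo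
  have hleft : IntervalIntegrable (fun x => deriv (bump a) x ^ 2) volume (-a) 0 := by
    rw [IntervalIntegrable.iff_comp_neg]
    simpa [deriv_bump_neg_sq] using hright.symm
  refine ⟨hleft.trans hright, hF, ?_⟩
  have hsymm : ∫ x in (-a)..0, deriv (bump a) x ^ 2 = ∫ x in 0..a, deriv (bump a) x ^ 2 := by
    have h := intervalIntegral.integral_comp_neg (a := 0) (b := a) fun x => deriv (bump a) x ^ 2
    simp only [deriv_bump_neg_sq, neg_zero] at h
    exact h.symm
  rw [← intervalIntegral.integral_add_adjacent_intervals hleft hright, hsymm,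
    intervalIntegral.integral_of_le ha.le, integral_Ioc_eq_integral_Ioo,
    setIntegral_congr_fun measurableSet_Ioo fun x hx => deriv_bump_sq_eq hx,
    integral_const_mul, hint]
  ring
end

section
/- Define I(a) = (∫_{−a}^{a} θ_a(x)² dx) / (∫_{−a}^{a} θ_a'(x)² dx) for a > 0, where θ_a is the standard bump function of half-width a. Then I(a) = a⁴ + O(a⁶) as a → 0⁺; i.e., the function a ↦ I(a) − a⁴ is O(a⁶) as a tends to 0 from the right. In particular, I(a) → 0 as a → 0⁺. -/
open Real Set Filter

/-- The ratio `I(a) = (∫ θ_a²) / (∫ θ_a'²)` used to bound the critical adiabatic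
index. -/
noncomputable def Iratio (a : ℝ) : ℝ :=
  (∫ x in (-a)..a, (bump a x) ^ 2) / (∫ x in (-a)..a, (deriv (bump a) x) ^ 2)

lemma bump_eq_expNegInvGlue {a : ℝ} (ha : 0 < a) (x : ℝ) :
    bump a x = Real.exp (1 / a ^ 2) * expNegInvGlue (a ^ 2 - x ^ 2) := by
  have h : |x| < a ↔ 0 < a ^ 2 - x ^ 2 := by
    rw [sub_pos, sq_lt_sq, abs_of_pos ha]
  by_cases hx : |x| < a
  · have hy := h.1 hx
    rw [bump, if_pos hx, expNegInvGlue, if_neg hy.not_ge]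
    congr 2
    rw [one_div, ← inv_neg, neg_sub]
  · rw [bump, if_neg hx, expNegInvGlue.zero_of_nonpos (not_lt.1 fun hy => hx (h.2 hy)), mul_zero]

lemma continuous_inv_pow_mul_expNegInvGlue (k : ℕ) :
    Continuous fun y : ℝ => y⁻¹ ^ k * expNegInvGlue y := by
  simpa using expNegInvGlue.continuous_polynomial_eval_inv_mul (Polynomial.X ^ k)

lemma continuous_expNegInvGlue : Continuous expNegInvGlue := by
  simpa using continuous_inv_pow_mul_expNegInvGlue 0

lemma continuous_inv_pow_mul_expNegInvGlue_sq (a : ℝ) (k : ℕ) :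
    Continuous fun x : ℝ => (a ^ 2 - x ^ 2)⁻¹ ^ k * expNegInvGlue (a ^ 2 - x ^ 2) ^ 2 := by
  have hy : Continuous fun x : ℝ => a ^ 2 - x ^ 2 := by fun_prop
  have h := ((continuous_inv_pow_mul_expNegInvGlue k).comp hy).mul
    (continuous_expNegInvGlue.comp hy)
  exact h.congr fun x => by
    simp only [Function.comp_apply, Pi.mul_apply]
    ring

lemma hasDerivAt_expNegInvGlue (y : ℝ) :
    HasDerivAt expNegInvGlue (y⁻¹ ^ 2 * expNegInvGlue y) y := by
  simpa using expNegInvGlue.hasDerivAt_polynomial_eval_inv_mul 1 y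

lemma hasDerivAt_inv_sq_mul_expNegInvGlue (y : ℝ) :
    HasDerivAt (fun y : ℝ => y⁻¹ ^ 2 * expNegInvGlue y)
      ((y⁻¹ ^ 4 - 2 * y⁻¹ ^ 3) * expNegInvGlue y) y := by
  have h := expNegInvGlue.hasDerivAt_polynomial_eval_inv_mul (Polynomial.X ^ 2) y
  simp only [Polynomial.derivative_X_pow, Polynomial.eval_mul, Polynomial.eval_sub,
    Polynomial.eval_pow, Polynomial.eval_X, Polynomial.eval_C] at h
  exact h.congr_deriv (by push_cast; ring)

lemma hasDerivAt_sq_sub_sq (a x : ℝ) :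
    HasDerivAt (fun x : ℝ => a ^ 2 - x ^ 2) (-(2 * x)) x := by
  simpa using (hasDerivAt_pow 2 x).const_sub (a ^ 2)

lemma deriv_bump {a : ℝ} (ha : 0 < a) (x : ℝ) :
    deriv (bump a) x = Real.exp (1 / a ^ 2) *
      ((a ^ 2 - x ^ 2)⁻¹ ^ 2 * expNegInvGlue (a ^ 2 - x ^ 2) * -(2 * x)) := by
  rw [funext (bump_eq_expNegInvGlue ha)]
  exact (((hasDerivAt_expNegInvGlue _).comp x (hasDerivAt_sq_sub_sq a x)).const_mul _).deriv

/-- Integration by parts for `x · (a² - x²)⁻² · exp(-2/(a² - x²))`, which vanishes at `±a`. -/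
lemma integral_four_mul_sq_mul_inv_pow_four (a : ℝ) :
    ∫ x in (-a)..a, 4 * x ^ 2 * ((a ^ 2 - x ^ 2)⁻¹ ^ 4 * expNegInvGlue (a ^ 2 - x ^ 2) ^ 2) =
      ∫ x in (-a)..a, ((a ^ 2 - x ^ 2)⁻¹ ^ 2 * expNegInvGlue (a ^ 2 - x ^ 2) ^ 2 +
        4 * x ^ 2 * ((a ^ 2 - x ^ 2)⁻¹ ^ 3 * expNegInvGlue (a ^ 2 - x ^ 2) ^ 2)) := by
  have c2 := continuous_inv_pow_mul_expNegInvGlue_sq a 2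
  have c3 := continuous_inv_pow_mul_expNegInvGlue_sq a 3
  have c4 := continuous_inv_pow_mul_expNegInvGlue_sq a 4
  have cx : Continuous fun x : ℝ => 4 * x ^ 2 := by fun_prop
  have i1 := (c2.add (cx.mul c3)).intervalIntegrable (μ := MeasureTheory.volume) (-a) a
  have i2 := (cx.mul c4).intervalIntegrable (μ := MeasureTheory.volume) (-a) a
  have h := intervalIntegral.integral_eq_sub_of_hasDerivAt (a := -a) (b := a)
    (f := fun x : ℝ => x * ((a ^ 2 - x ^ 2)⁻¹ ^ 2 * expNegInvGlue (a ^ 2 - x ^ 2)) *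
      expNegInvGlue (a ^ 2 - x ^ 2)) (fun x _ => by
      have hy := hasDerivAt_sq_sub_sq a x
      have hF := ((hasDerivAt_id x).mul ((hasDerivAt_inv_sq_mul_expNegInvGlue _).comp x hy)).mul
        ((hasDerivAt_expNegInvGlue _).comp x hy)
      refine hF.congr_deriv (g' := ((a ^ 2 - x ^ 2)⁻¹ ^ 2 * expNegInvGlue (a ^ 2 - x ^ 2) ^ 2 +
        4 * x ^ 2 * ((a ^ 2 - x ^ 2)⁻¹ ^ 3 * expNegInvGlue (a ^ 2 - x ^ 2) ^ 2)) -
        4 * x ^ 2 * ((a ^ 2 - x ^ 2)⁻¹ ^ 4 * expNegInvGlue (a ^ 2 - x ^ 2) ^ 2)) ?_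
      simp only [Function.comp_apply, id, Pi.mul_apply]
      ring) (i1.sub i2)
  rw [intervalIntegral.integral_sub i1 i2] at h
  simp only [even_two, Even.neg_pow, sub_self, expNegInvGlue.zero, mul_zero] at h
  exact (sub_eq_zero.1 h).symm

lemma Iratio_eq {a : ℝ} (ha : 0 < a) :
    Iratio a = (∫ x in (-a)..a, expNegInvGlue (a ^ 2 - x ^ 2) ^ 2) /
      ∫ x in (-a)..a, 4 * x ^ 2 * ((a ^ 2 - x ^ 2)⁻¹ ^ 4 * expNegInvGlue (a ^ 2 - x ^ 2) ^ 2) := by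
  have hN (x : ℝ) : bump a x ^ 2 =
      Real.exp (1 / a ^ 2) ^ 2 * expNegInvGlue (a ^ 2 - x ^ 2) ^ 2 := by
    rw [bump_eq_expNegInvGlue ha, mul_pow]
  have hD (x : ℝ) : deriv (bump a) x ^ 2 = Real.exp (1 / a ^ 2) ^ 2 *
      (4 * x ^ 2 * ((a ^ 2 - x ^ 2)⁻¹ ^ 4 * expNegInvGlue (a ^ 2 - x ^ 2) ^ 2)) := by
    rw [deriv_bump ha]
    ring
  simp only [Iratio, hN, hD, intervalIntegral.integral_const_mul]
  exact mul_div_mul_left _ _ (pow_ne_zero 2 (Real.exp_ne_zero _))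

lemma one_le_inv_sq_add_inv_cube {a x : ℝ} (hy : 0 < a ^ 2 - x ^ 2) :
    1 ≤ a ^ 4 * ((a ^ 2 - x ^ 2)⁻¹ ^ 2 + 4 * x ^ 2 * (a ^ 2 - x ^ 2)⁻¹ ^ 3) := by
  have h1 : 1 ≤ a ^ 4 * (a ^ 2 - x ^ 2)⁻¹ ^ 2 := by
    rw [inv_pow, ← div_eq_mul_inv, one_le_div (by positivity)]
    nlinarith [sq_nonneg x, sq_nonneg a]
  have h2 : 0 ≤ a ^ 4 * (4 * x ^ 2 * (a ^ 2 - x ^ 2)⁻¹ ^ 3) := by positivity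
  linarith

lemma inv_sq_add_inv_cube_sub_one_le {a x : ℝ} (hy : 0 < a ^ 2 - x ^ 2) :
    a ^ 4 * ((a ^ 2 - x ^ 2)⁻¹ ^ 2 + 4 * x ^ 2 * (a ^ 2 - x ^ 2)⁻¹ ^ 3) - 1 ≤
      3 / 2 * a ^ 6 * (4 * x ^ 2 * (a ^ 2 - x ^ 2)⁻¹ ^ 4) := by
  obtain ⟨y, hy'⟩ : ∃ y, y = a ^ 2 - x ^ 2 := ⟨_, rfl⟩
  rw [← hy'] at hy ⊢
  have ha2 : a ^ 2 = x ^ 2 + y := by linarith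
  have ha4 : a ^ 4 = (x ^ 2 + y) ^ 2 := by rw [← ha2]; ring
  have ha6 : a ^ 6 = (x ^ 2 + y) ^ 3 := by rw [← ha2]; ring
  rw [ha4, ha6, ← sub_nonneg]
  have key : 3 / 2 * (x ^ 2 + y) ^ 3 * (4 * x ^ 2 * y⁻¹ ^ 4) -
      ((x ^ 2 + y) ^ 2 * (y⁻¹ ^ 2 + 4 * x ^ 2 * y⁻¹ ^ 3) - 1) =
      (6 * x ^ 8 + 14 * x ^ 6 * y + 9 * x ^ 4 * y ^ 2) * y⁻¹ ^ 4 := by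
    field_simp
    ring
  rw [key]
  positivity

lemma abs_Iratio_sub_le {a : ℝ} (ha : 0 < a) : |Iratio a - a ^ 4| ≤ 3 / 2 * a ^ 6 := by
  have hab : -a ≤ a := by linarith
  have c0 : Continuous fun x : ℝ => expNegInvGlue (a ^ 2 - x ^ 2) ^ 2 := by
    simpa using continuous_inv_pow_mul_expNegInvGlue_sq a 0
  have c2 := continuous_inv_pow_mul_expNegInvGlue_sq a 2
  have c3 := continuous_inv_pow_mul_expNegInvGlue_sq a 3
  have c4 := continuous_inv_pow_mul_expNegInvGlue_sq a 4
  have cx : Continuous fun x : ℝ => 4 * x ^ 2 := by fun_prop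
  have i0 := c0.intervalIntegrable (μ := MeasureTheory.volume) (-a) a
  have i1 : IntervalIntegrable (fun x : ℝ => a ^ 4 *
      ((a ^ 2 - x ^ 2)⁻¹ ^ 2 * expNegInvGlue (a ^ 2 - x ^ 2) ^ 2 +
        4 * x ^ 2 * ((a ^ 2 - x ^ 2)⁻¹ ^ 3 * expNegInvGlue (a ^ 2 - x ^ 2) ^ 2)))
      MeasureTheory.volume (-a) a :=
    (continuous_const.mul (c2.add (cx.mul c3))).intervalIntegrable _ _
  have i2 : IntervalIntegrable (fun x : ℝ => 3 / 2 * a ^ 6 *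
      (4 * x ^ 2 * ((a ^ 2 - x ^ 2)⁻¹ ^ 4 * expNegInvGlue (a ^ 2 - x ^ 2) ^ 2)))
      MeasureTheory.volume (-a) a :=
    (continuous_const.mul (cx.mul c4)).intervalIntegrable _ _
  have hpos : 0 < ∫ x in (-a)..a, expNegInvGlue (a ^ 2 - x ^ 2) ^ 2 := by
    refine intervalIntegral.intervalIntegral_pos_of_pos_on i0 (fun x hx => ?_) (by linarith)
    have : 0 < a ^ 2 - x ^ 2 := by nlinarith [hx.1, hx.2]
    exact pow_pos (expNegInvGlue.pos_of_pos this) 2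
  have hle := intervalIntegral.integral_mono_on hab i0 i1 fun x _ => by
    rcases le_or_gt (a ^ 2 - x ^ 2) 0 with hy | hy
    · simp [expNegInvGlue.zero_of_nonpos hy]
    · have := mul_le_mul_of_nonneg_right (one_le_inv_sq_add_inv_cube hy)
        (sq_nonneg (expNegInvGlue (a ^ 2 - x ^ 2)))
      linarith
  have hge := intervalIntegral.integral_mono_on hab (i1.sub i0) i2 fun x _ => by
    rcases le_or_gt (a ^ 2 - x ^ 2) 0 with hy | hy
    · simp [expNegInvGlue.zero_of_nonpos hy]
    · have := mul_le_mul_of_nonneg_right (inv_sq_add_inv_cube_sub_one_le hy)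
        (sq_nonneg (expNegInvGlue (a ^ 2 - x ^ 2)))
      linarith
  rw [intervalIntegral.integral_sub i1 i0] at hge
  simp only [intervalIntegral.integral_const_mul] at hle hge
  rw [← integral_four_mul_sq_mul_inv_pow_four] at hle hge
  rw [Iratio_eq ha]
  set N := ∫ x in (-a)..a, expNegInvGlue (a ^ 2 - x ^ 2) ^ 2
  set D := ∫ x in (-a)..a,
    4 * x ^ 2 * ((a ^ 2 - x ^ 2)⁻¹ ^ 4 * expNegInvGlue (a ^ 2 - x ^ 2) ^ 2)
  have hD : 0 < D := pos_of_mul_pos_right (hpos.trans_le hle) (by positivity)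
  have h1 : N / D ≤ a ^ 4 := (div_le_iff₀ hD).2 hle
  have h2 : a ^ 4 - 3 / 2 * a ^ 6 ≤ N / D := (le_div_iff₀ hD).2 (by linarith)
  exact abs_le.2 ⟨by linarith, by linarith [pow_pos ha 6]⟩

/-- `I(a) = a⁴ + O(a⁶)` as `a → 0⁺`; in particular `I(a) → 0` as `a → 0⁺`. -/
theorem Iratio_asymptotics :
    Asymptotics.IsBigO (nhdsWithin (0 : ℝ) (Set.Ioi 0))
      (fun a => Iratio a - a ^ 4) (fun a => a ^ 6) ∧
    Filter.Tendsto Iratio (nhdsWithin (0 : ℝ) (Set.Ioi 0)) (nhds 0) := by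
  have hO : Asymptotics.IsBigO (nhdsWithin (0 : ℝ) (Set.Ioi 0))
      (fun a => Iratio a - a ^ 4) (fun a => a ^ 6) := by
    refine Asymptotics.IsBigO.of_bound (3 / 2) ?_
    filter_upwards [self_mem_nhdsWithin] with a ha
    rw [Real.norm_eq_abs, Real.norm_of_nonneg (pow_pos ha 6).le]
    exact abs_Iratio_sub_le ha
  have hpow {n : ℕ} (hn : n ≠ 0) :
      Filter.Tendsto (fun a : ℝ => a ^ n) (nhdsWithin (0 : ℝ) (Set.Ioi 0)) (nhds 0) := by
    have h := (continuous_pow (M := ℝ) n).tendsto 0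
    rw [zero_pow hn] at h
    exact h.mono_left nhdsWithin_le_nhds
  refine ⟨hO, ?_⟩
  simpa using (hO.trans_tendsto (hpow (by norm_num))).add (hpow (n := 4) (by norm_num))
end

section
/- Let R > 0 and M < 0, and consider the Schwarzschild star of radius R and mass M with constant density ρ₀ = 3M/(4πR³), mass function m(r) = M·r³/R³, and pressure P(r) = ρ₀·(√(1 − 2M/R) − √(1 − 2M·r²/R³)) / (√(1 − 2M·r²/R³) − 3·√(1 − 2M/R)). Then P is well defined and differentiable on [0, R], P(R) = 0, and for every r ∈ (0, R) the TOV equation P'(r) = −(P(r)+ρ₀)·(4π·P(r)·r³ + m(r)) / (r·(r − 2·m(r))) holds. -/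
open Real Set

/-- The pressure of the Schwarzschild (constant-density) star of radius `R` and
mass `M`. -/
noncomputable def schwP (R M r : ℝ) : ℝ :=
  (3 * M / (4 * Real.pi * R ^ 3)) *
    (Real.sqrt (1 - 2 * M / R) - Real.sqrt (1 - 2 * M * r ^ 2 / R ^ 3)) /
    (Real.sqrt (1 - 2 * M * r ^ 2 / R ^ 3) - 3 * Real.sqrt (1 - 2 * M / R))

/-- The mass function of the Schwarzschild star. -/
noncomputable def schwm (R M r : ℝ) : ℝ := M * r ^ 3 / R ^ 3

/-- The radicand of the metric function is at least one for negative mass. -/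
theorem one_le_schwarzschild_radicand {R M : ℝ} (hR : 0 < R) (hM : M < 0) (r : ℝ) :
    1 ≤ 1 - 2 * M * r ^ 2 / R ^ 3 := by
  have h : 2 * M * r ^ 2 / R ^ 3 ≤ 0 :=
    div_nonpos_of_nonpos_of_nonneg
      (mul_nonpos_of_nonpos_of_nonneg (by linarith) (sq_nonneg r)) (by positivity)
  linarith

/-- At the surface the radicand takes the value `1 - 2 * M / R`. -/
theorem schwarzschild_radicand_surface {R : ℝ} (hR : 0 < R) (M : ℝ) :
    1 - 2 * M * R ^ 2 / R ^ 3 = 1 - 2 * M / R := by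
  field_simp

theorem schwP_denominator_ne_zero {R M r : ℝ} (hR : 0 < R) (hM : M < 0)
    (hr : r ∈ Set.Icc (0 : ℝ) R) :
    √(1 - 2 * M * r ^ 2 / R ^ 3) - 3 * √(1 - 2 * M / R) ≠ 0 := by
  rw [← schwarzschild_radicand_surface hR M]
  have hpos : 0 < √(1 - 2 * M * R ^ 2 / R ^ 3) :=
    Real.sqrt_pos.2 (zero_lt_one.trans_le (one_le_schwarzschild_radicand hR hM R))
  have hsq : r ^ 2 ≤ R ^ 2 := pow_le_pow_left₀ hr.1 hr.2 2
  have hmul : 2 * M * R ^ 2 ≤ 2 * M * r ^ 2 :=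
    mul_le_mul_of_nonpos_left hsq (by linarith)
  have hle : √(1 - 2 * M * r ^ 2 / R ^ 3) ≤ √(1 - 2 * M * R ^ 2 / R ^ 3) := by
    gcongr
  exact ne_of_lt (by linarith)

theorem hasDerivAt_schwP {R M r : ℝ} (hR : 0 < R) (hM : M < 0)
    (hr : r ∈ Set.Icc (0 : ℝ) R) :
    HasDerivAt (schwP R M)
      ((schwP R M r + 3 * M / (4 * Real.pi * R ^ 3)) * (2 * M * r) /
        (R ^ 3 * √(1 - 2 * M * r ^ 2 / R ^ 3) *
          (√(1 - 2 * M * r ^ 2 / R ^ 3) - 3 * √(1 - 2 * M / R)))) r := by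
  have hden := schwP_denominator_ne_zero hR hM hr
  have hrad : 0 < 1 - 2 * M * r ^ 2 / R ^ 3 :=
    zero_lt_one.trans_le (one_le_schwarzschild_radicand hR hM r)
  have hs : √(1 - 2 * M * r ^ 2 / R ^ 3) ≠ 0 := (Real.sqrt_pos.2 hrad).ne'
  have hsqrt := (((((hasDerivAt_id' r).pow 2).const_mul (2 * M)).div_const
    (R ^ 3)).const_sub 1).sqrt hrad.ne'
  have h := ((hsqrt.const_sub √(1 - 2 * M / R)).const_mul
    (3 * M / (4 * Real.pi * R ^ 3))).div (hsqrt.sub_const (3 * √(1 - 2 * M / R))) hden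
  refine h.congr_deriv ?_
  simp only [schwP]
  generalize √(1 - 2 * M * r ^ 2 / R ^ 3) = s at hden hs ⊢
  generalize √(1 - 2 * M / R) = a at hden ⊢
  field_simp
  ring

/-- The negative-mass Schwarzschild star: the pressure is well defined (nonvanishing
denominator) and differentiable on `[0, R]`, vanishes at the surface, and satisfies
the TOV equation in the interior. -/
theorem schwarzschild_star_solves_TOV (R M : ℝ) (hR : 0 < R) (hM : M < 0) :
    (∀ r ∈ Set.Icc (0 : ℝ) R,
      Real.sqrt (1 - 2 * M * r ^ 2 / R ^ 3) - 3 * Real.sqrt (1 - 2 * M / R) ≠ 0) ∧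
    DifferentiableOn ℝ (schwP R M) (Set.Icc 0 R) ∧
    schwP R M R = 0 ∧
    ∀ r ∈ Set.Ioo (0 : ℝ) R,
      deriv (schwP R M) r =
        -(schwP R M r + 3 * M / (4 * Real.pi * R ^ 3)) *
          (4 * Real.pi * schwP R M r * r ^ 3 + schwm R M r) /
          (r * (r - 2 * schwm R M r)) := by
  refine ⟨fun r hr => schwP_denominator_ne_zero hR hM hr,
    fun r hr => (hasDerivAt_schwP hR hM hr).differentiableAt.differentiableWithinAt,
    ?_, fun r hr => ?_⟩
  · simp [schwP, schwarzschild_radicand_surface hR M]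
  · have hmem := Set.Ioo_subset_Icc_self hr
    rw [(hasDerivAt_schwP hR hM hmem).deriv]
    have hden := schwP_denominator_ne_zero hR hM hmem
    have hrad : 0 < 1 - 2 * M * r ^ 2 / R ^ 3 :=
      zero_lt_one.trans_le (one_le_schwarzschild_radicand hR hM r)
    have hs : √(1 - 2 * M * r ^ 2 / R ^ 3) ≠ 0 := (Real.sqrt_pos.2 hrad).ne'
    have hr0 : r ≠ 0 := hr.1.ne'
    have hmass : r - 2 * schwm R M r = r * √(1 - 2 * M * r ^ 2 / R ^ 3) ^ 2 := by
      rw [Real.sq_sqrt hrad.le, schwm]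
      ring
    rw [hmass]
    simp only [schwP, schwm]
    generalize √(1 - 2 * M * r ^ 2 / R ^ 3) = s at hden hs ⊢
    generalize √(1 - 2 * M / R) = a at hden ⊢
    field_simp
    ring
end

section
/- Let R > 0 and M < 0, and let ρ₀ = 3M/(4πR³) and P be the Schwarzschild-star pressure. Then for all r ∈ [0, R]: ρ₀ + P(r) = ρ₀·2·√(1 − 2M/R) / (3·√(1 − 2M/R) − √(1 − 2M·r²/R³)), the bracketed factor 2·√(1 − 2M/R) / (3·√(1 − 2M/R) − √(1 − 2M·r²/R³)) is strictly positive, and hence ρ₀ + P(r) < 0 for every r ∈ [0, R]: the negative-mass Schwarzschild star violates the null energy condition at every point. -/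
open Real Set

/-- The negative-mass Schwarzschild star violates the null energy condition at every
point: `ρ₀ + P(r) < 0` on `[0, R]`. -/
theorem schwarzschild_star_violates_NEC (R M : ℝ) (hR : 0 < R) (hM : M < 0) :
    ∀ r ∈ Set.Icc (0 : ℝ) R,
      (3 * M / (4 * Real.pi * R ^ 3) + schwP R M r =
        (3 * M / (4 * Real.pi * R ^ 3)) *
          (2 * Real.sqrt (1 - 2 * M / R) /
            (3 * Real.sqrt (1 - 2 * M / R) - Real.sqrt (1 - 2 * M * r ^ 2 / R ^ 3)))) ∧
      (0 < 2 * Real.sqrt (1 - 2 * M / R) /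
        (3 * Real.sqrt (1 - 2 * M / R) - Real.sqrt (1 - 2 * M * r ^ 2 / R ^ 3))) ∧
      3 * M / (4 * Real.pi * R ^ 3) + schwP R M r < 0 := by
  rintro r ⟨hr0, hrR⟩
  have ha : 0 < Real.sqrt (1 - 2 * M / R) := by
    have : 2 * M / R < 0 := div_neg_of_neg_of_pos (by linarith) hR
    exact Real.sqrt_pos.2 (by linarith)
  have hba : Real.sqrt (1 - 2 * M * r ^ 2 / R ^ 3) ≤ Real.sqrt (1 - 2 * M / R) := by
    refine Real.sqrt_le_sqrt (sub_le_sub_left ?_ 1)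
    rw [div_le_div_iff₀ hR (by positivity)]
    have hsq : r ^ 2 ≤ R ^ 2 := by gcongr
    nlinarith [mul_nonneg (mul_nonneg (neg_nonneg.2 hM.le) hR.le) (sub_nonneg.2 hsq)]
  have hρ : 3 * M / (4 * Real.pi * R ^ 3) < 0 :=
    div_neg_of_neg_of_pos (by linarith) (by positivity)
  unfold schwP
  generalize Real.sqrt (1 - 2 * M / R) = a at *
  generalize Real.sqrt (1 - 2 * M * r ^ 2 / R ^ 3) = b at *
  generalize 3 * M / (4 * Real.pi * R ^ 3) = ρ at *
  have hd : 0 < 3 * a - b := by linarith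
  have hpos : 0 < 2 * a / (3 * a - b) := by positivity
  have heq : ρ + ρ * (a - b) / (b - 3 * a) = ρ * (2 * a / (3 * a - b)) := by
    rw [← neg_sub (3 * a) b, div_neg, ← sub_eq_add_neg, ← mul_div_assoc,
      sub_eq_iff_eq_add, ← add_div, eq_div_iff hd.ne']
    ring
  exact ⟨heq, hpos, heq ▸ mul_neg_of_neg_of_pos hρ hpos⟩
end

section
/- Let 0 < r₀ < R, let g : ℝ → ℝ be continuously differentiable, let P : [r₀, R] → ℝ be differentiable with ρ = g ∘ P, and let m : [r₀, R] → ℝ be continuous with r − 2·m(r) > 0 on [r₀, R]. Assume the TOV equation holds on [r₀, R] and that P(r₀) + ρ(r₀) = 0. Then P(r) + ρ(r) = 0 for all r ∈ [r₀, R] and P is constant on [r₀, R]: once a star with a C¹ barotropic equation of state (with finite dρ/dP) reaches a point where P + ρ = 0, the pressure and density freeze and the stellar profile becomes constant from that radius onward. -/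
open Real Set

/-- If the derivative in the interior of an interval is given by a continuous function, then that
function gives the right derivative at every point, including the left endpoint. -/
theorem hasDerivWithinAt_Ici_of_deriv_eqOn_Ioo {f D : ℝ → ℝ} {a b : ℝ}
    (hf : DifferentiableOn ℝ f (Icc a b)) (hD : ContinuousOn D (Icc a b))
    (h : ∀ x ∈ Ioo a b, deriv f x = D x) {x : ℝ} (hx : x ∈ Ico a b) :
    HasDerivWithinAt f (D x) (Ici x) x := by
  have hsub : Ioo x b ⊆ Ioo a b := Ioo_subset_Ioo_left hx.1
  have hsub' : Ioo x b ⊆ Icc a b := hsub.trans Ioo_subset_Icc_self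
  have hxI : x ∈ Icc a b := Ico_subset_Icc_self hx
  have hmem : Ioo x b ∈ nhdsWithin x (Ioi x) := Ioo_mem_nhdsGT hx.2
  refine hasDerivWithinAt_Ici_of_tendsto_deriv (hf.mono hsub')
    ((hf.continuousOn x hxI).mono hsub') hmem ?_
  have hlim : Filter.Tendsto D (nhdsWithin x (Ioi x)) (nhds (D x)) :=
    (hD x hxI).mono_left (nhdsWithin_le_of_mem (Filter.mem_of_superset hmem hsub'))
  refine hlim.congr' ?_
  filter_upwards [hmem] with y hy using (h y (hsub hy)).symm

/-- Once a barotropic TOV solution with a `C¹` equation of state `ρ = g(P)` reaches a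
point where `P + ρ = 0`, the combination `P + ρ` remains zero and the pressure profile
freezes (becomes constant) from that radius onward. -/
theorem tov_freezes_after_nec_saturation
    (r₀ R : ℝ) (hr₀ : 0 < r₀) (hr₀R : r₀ < R)
    (g : ℝ → ℝ) (hg : ContDiff ℝ 1 g)
    (P : ℝ → ℝ) (hP : DifferentiableOn ℝ P (Set.Icc r₀ R))
    (ρ : ℝ → ℝ) (hρ : ρ = g ∘ P)
    (m : ℝ → ℝ) (hm : ContinuousOn m (Set.Icc r₀ R))
    (hhor : ∀ r ∈ Set.Icc r₀ R, 0 < r - 2 * m r)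
    (hTOV : ∀ r ∈ Set.Icc r₀ R,
      deriv P r = -(P r + ρ r) * (4 * Real.pi * P r * r ^ 3 + m r) / (r * (r - 2 * m r)))
    (hsat : P r₀ + ρ r₀ = 0) :
    (∀ r ∈ Set.Icc r₀ R, P r + ρ r = 0) ∧
    ∀ r ∈ Set.Icc r₀ R, P r = P r₀ := by
  subst hρ
  set A : ℝ → ℝ := fun r ↦
    -((4 * Real.pi * P r * r ^ 3 + m r) / (r * (r - 2 * m r))) with hA
  have hPc : ContinuousOn P (Icc r₀ R) := hP.continuousOn
  have hAc : ContinuousOn A (Icc r₀ R) := by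
    refine ContinuousOn.neg (ContinuousOn.div (by fun_prop) (by fun_prop) fun r hr ↦ ?_)
    exact (mul_pos (hr₀.trans_le hr.1) (hhor r hr)).ne'
  have hgP : ContinuousOn (fun r ↦ g (P r)) (Icc r₀ R) := hg.continuous.comp_continuousOn hPc
  have hg' : ContinuousOn (fun r ↦ deriv g (P r)) (Icc r₀ R) :=
    (hg.continuous_deriv le_rfl).comp_continuousOn hPc
  have hsum : ContinuousOn (fun r ↦ P r + g (P r)) (Icc r₀ R) := hPc.add hgP
  have hder : ∀ r ∈ Ico r₀ R, HasDerivWithinAt P (A r * (P r + g (P r))) (Ici r) r := by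
    intro r hr
    refine hasDerivWithinAt_Ici_of_deriv_eqOn_Ioo
      (D := fun r ↦ A r * (P r + g (P r))) hP (hAc.mul hsum) (fun x hx ↦ ?_) hr
    rw [hTOV x (Ioo_subset_Icc_self hx)]
    simp only [hA, Function.comp_apply]
    ring
  obtain ⟨K, hK⟩ := isCompact_Icc.exists_bound_of_continuousOn
    ((continuousOn_const (c := (1 : ℝ))).add hg' |>.mul hAc)
  have hzero : ∀ r ∈ Icc r₀ R, P r + g (P r) = 0 := by
    refine eq_zero_of_abs_deriv_le_mul_abs_self_of_eq_zero_right (K := K)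
      (f' := fun r ↦ ((1 + deriv g (P r)) * A r) * (P r + g (P r))) hsum (fun r hr ↦ ?_) hsat
      fun r hr ↦ ?_
    · have hgd : HasDerivAt g (deriv g (P r)) (P r) :=
        (hg.differentiable one_ne_zero (P r)).hasDerivAt
      refine ((hder r hr).add (hgd.comp_hasDerivWithinAt r (hder r hr))).congr_deriv ?_
      ring
    · rw [norm_mul]
      exact mul_le_mul_of_nonneg_right (hK r (Ico_subset_Icc_self hr)) (norm_nonneg _)
  refine ⟨hzero, constant_of_has_deriv_right_zero hPc fun r hr ↦ ?_⟩
  simpa [hzero r (Ico_subset_Icc_self hr)] using hder r hr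
end
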